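/- Let d ∈ ℝ, p₀ᵢ > 0, p₀ⱼ > 0 and pᵢⱼ ∈ ℝ with pᵢⱼ² < p₀ᵢ p₀ⱼ. Let κ e^{λ(d)} be the bivariate Gaussian density with mean (−d,−d) and covariance [[p₀ᵢ, pᵢⱼ],[pᵢⱼ, p₀ⱼ]], i.e. κ = (2π √(p₀ᵢ p₀ⱼ − pᵢⱼ²))^{-1} and λ(d)(wᵢ, wⱼ) = −[(wᵢ+d)² p₀ⱼ + (wⱼ+d)² p₀ᵢ − 2 pᵢⱼ (wᵢ+d)(wⱼ+d)] / (2(p₀ᵢ p₀ⱼ − pᵢⱼ²)). Then ∫_{ℝ²} wᵢ sgn(wⱼ) κ e^{λ(d)(wᵢ,wⱼ)} dwᵢ dwⱼ = ε₁ pᵢⱼ − ε₂ d (p₀ⱼ − pᵢⱼ), where ε₁ = (1/p₀ⱼ)( √(2p₀ⱼ/π) e^{−d²/(2p₀ⱼ)} + d · erf(d/√(2p₀ⱼ)) ) and ε₂ = −(1/p₀ⱼ) erf(d/√(2p₀ⱼ)). -/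

import Mathlib

open Real MeasureTheory

/-- The error function `erf x = (2/√π) ∫_0^x e^{-z²} dz`. -/
noncomputable def erf (x : ℝ) : ℝ :=
  (2 / Real.sqrt Real.pi) * ∫ z in (0 : ℝ)..x, Real.exp (-z ^ 2)

/-- The exponent `λ(c)(wᵢ, wⱼ)` of the bivariate Gaussian density with mean `(-c,-c)`
and covariance `[[p₀ᵢ, pᵢⱼ], [pᵢⱼ, p₀ⱼ]]`. -/
noncomputable def lam (p0i p0j pij c wi wj : ℝ) : ℝ :=
  -((wi + c) ^ 2 * p0j + (wj + c) ^ 2 * p0i - 2 * pij * (wi + c) * (wj + c)) /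
    (2 * (p0i * p0j - pij ^ 2))

/-- A Gaussian with centre `m` and precision `2 b` has first moment `m` times its mass. -/
lemma integral_id_mul_exp_neg_mul_sub_sq {b : ℝ} (hb : 0 < b) (m : ℝ) :
    ∫ x : ℝ, x * Real.exp (-b * (x - m) ^ 2) = m * Real.sqrt (Real.pi / b) := by
  have hshift : ∫ x : ℝ, x * Real.exp (-b * (x - m) ^ 2)
      = ∫ x : ℝ, (x + m) * Real.exp (-b * x ^ 2) := by
    rw [← integral_sub_right_eq_self (fun x : ℝ => (x + m) * Real.exp (-b * x ^ 2)) m]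
    simp
  have hodd : ∫ x : ℝ, x * Real.exp (-b * x ^ 2) = 0 := by
    have h := integral_neg_eq_self (fun x : ℝ => x * Real.exp (-b * x ^ 2)) volume
    simp only [neg_sq, neg_mul, integral_neg] at h ⊢
    linarith
  rw [hshift]
  simp_rw [add_mul]
  rw [integral_add (integrable_mul_exp_neg_mul_sq hb) ((integrable_exp_neg_mul_sq hb).const_mul m),
    hodd, integral_const_mul, integral_gaussian, zero_add]

/-- Integrating against a shifted sign function splits the line at the jump. -/
lemma integral_sign_sub_mul {g : ℝ → ℝ} (hg : Integrable g) (a : ℝ) :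
    ∫ z : ℝ, Real.sign (z - a) * g z = (∫ z in Set.Ioi a, g z) - ∫ z in Set.Iio a, g z := by
  have hpoint : ∀ z : ℝ, Real.sign (z - a) * g z
      = (Set.Ioi a).indicator g z - (Set.Iio a).indicator g z := by
    intro z
    rcases lt_trichotomy z a with h | h | h
    · simp [Real.sign_of_neg (sub_neg.mpr h), h, h.le]
    · simp [h]
    · simp [Real.sign_of_pos (sub_pos.mpr h), h, h.le]
  simp_rw [hpoint]
  rw [integral_sub (hg.indicator measurableSet_Ioi) (hg.indicator measurableSet_Iio),
    integral_indicator measurableSet_Ioi, integral_indicator measurableSet_Iio]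

lemma integrable_exp_neg_sq : Integrable fun z : ℝ => Real.exp (-z ^ 2) := by
  simpa using integrable_exp_neg_mul_sq one_pos

lemma integrable_id_mul_exp_neg_sq : Integrable fun z : ℝ => z * Real.exp (-z ^ 2) := by
  simpa using integrable_mul_exp_neg_mul_sq one_pos

lemma integral_sign_sub_mul_exp_neg_sq (a : ℝ) :
    ∫ z : ℝ, Real.sign (z - a) * Real.exp (-z ^ 2) = -(Real.sqrt Real.pi * erf a) := by
  have hint := integrable_exp_neg_sq
  rw [integral_sign_sub_mul hint, ← integral_Iic_eq_integral_Iio]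
  have hIic := intervalIntegral.integral_Iic_sub_Iic (a := 0) (b := a)
    hint.integrableOn hint.integrableOn
  have hIoi : ∫ z in Set.Ioi (0 : ℝ), Real.exp (-z ^ 2) = Real.sqrt Real.pi / 2 := by
    simpa using integral_gaussian_Ioi 1
  have htotal : ∫ z : ℝ, Real.exp (-z ^ 2) = Real.sqrt Real.pi := by
    simpa using integral_gaussian 1
  have hsplit (c : ℝ) := intervalIntegral.integral_Iic_add_Ioi (b := c)
    hint.integrableOn hint.integrableOn
  have hpi : Real.sqrt Real.pi ≠ 0 := by positivity
  have herf : Real.sqrt Real.pi * erf a = 2 * ∫ z in (0 : ℝ)..a, Real.exp (-z ^ 2) := by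
    rw [erf]
    field_simp
  linarith [hsplit 0, hsplit a]

lemma integral_sign_sub_mul_id_mul_exp_neg_sq (a : ℝ) :
    ∫ z : ℝ, Real.sign (z - a) * (z * Real.exp (-z ^ 2)) = Real.exp (-a ^ 2) := by
  have hint := integrable_id_mul_exp_neg_sq
  rw [integral_sign_sub_mul hint, ← integral_Iic_eq_integral_Iio]
  have hderiv : ∀ z : ℝ,
      HasDerivAt (fun z : ℝ => -(Real.exp (-z ^ 2) / 2)) (z * Real.exp (-z ^ 2)) z := by
    intro z
    refine (((hasDerivAt_pow 2 z).fun_neg.exp).div_const 2).fun_neg.congr_deriv ?_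
    push_cast
    ring
  have hsq : Filter.Tendsto (fun z : ℝ => Real.exp (-z ^ 2)) (Filter.cocompact ℝ) (nhds 0) := by
    simpa using tendsto_rpow_abs_mul_exp_neg_mul_sq_cocompact one_pos 0
  have hlim : Filter.Tendsto (fun z : ℝ => -(Real.exp (-z ^ 2) / 2))
      (Filter.cocompact ℝ) (nhds 0) := by
    simpa using (hsq.div_const 2).neg
  rw [integral_Ioi_of_hasDerivAt_of_tendsto' (fun z _ => hderiv z) hint.integrableOn
      (hlim.mono_left atTop_le_cocompact),
    integral_Iic_of_hasDerivAt_of_tendsto' (fun z _ => hderiv z) hint.integrableOn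
      (hlim.mono_left atBot_le_cocompact)]
  ring

lemma sign_mul_of_pos {c : ℝ} (hc : 0 < c) (x : ℝ) : Real.sign (c * x) = Real.sign x := by
  rcases lt_trichotomy x 0 with h | h | h
  · rw [Real.sign_of_neg h, Real.sign_of_neg (mul_neg_of_pos_of_neg hc h)]
  · simp [h]
  · rw [Real.sign_of_pos h, Real.sign_of_pos (mul_pos hc h)]

/-- Standardising a sign-weighted integral. -/
lemma integral_sign_mul_comp_add_div (g : ℝ → ℝ) {c : ℝ} (hc : 0 < c) (d : ℝ) :
    ∫ w : ℝ, Real.sign w * g ((w + d) / c)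
      = c * ∫ z : ℝ, Real.sign (z - d / c) * g z := by
  have hcne := hc.ne'
  have h := Measure.integral_comp_div (fun z => Real.sign (z - d / c) * g z) c
  rw [abs_of_pos hc, smul_eq_mul] at h
  rw [← h, ← integral_add_right_eq_self (fun x => Real.sign (x / c - d / c) * g (x / c)) d]
  congr 1
  ext w
  have hw : c * ((w + d) / c - d / c) = w := by
    field_simp
    ring
  rw [← sign_mul_of_pos hc ((w + d) / c - d / c), hw]

lemma lam_le {p0i p0j pij : ℝ} (hi : 0 < p0i) (hj : 0 < p0j) (hij : pij ^ 2 < p0i * p0j)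
    (c wi wj : ℝ) :
    lam p0i p0j pij c wi wj
      ≤ -(2 * (p0i + p0j))⁻¹ * (wi + c) ^ 2 + -(2 * (p0i + p0j))⁻¹ * (wj + c) ^ 2 := by
  have hD : 0 < p0i * p0j - pij ^ 2 := sub_pos.mpr hij
  have hnonneg : 0 ≤ ((p0j * (wi + c) - pij * (wj + c)) ^ 2
      + (pij * (wi + c) - p0i * (wj + c)) ^ 2)
        / (2 * (p0i + p0j) * (p0i * p0j - pij ^ 2)) := by positivity
  rw [← sub_nonneg]
  convert hnonneg using 1
  rw [lam]
  have hDne := hD.ne'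
  field_simp
  ring

lemma lam_eq_completed_square {p0i p0j pij : ℝ} (hj : 0 < p0j) (hij : pij ^ 2 < p0i * p0j)
    (c wi wj : ℝ) :
    lam p0i p0j pij c wi wj
      = -(p0j / (2 * (p0i * p0j - pij ^ 2))) * (wi - (-c + pij / p0j * (wj + c))) ^ 2
        + -(wj + c) ^ 2 / (2 * p0j) := by
  rw [lam]
  obtain ⟨D, hD⟩ : ∃ D, D = p0i * p0j - pij ^ 2 := ⟨_, rfl⟩
  have hDpos : 0 < D := hD ▸ sub_pos.mpr hij
  have hp0i : p0i = (D + pij ^ 2) / p0j := by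
    rw [hD]
    field_simp
    ring
  rw [← hD, hp0i]
  field_simp
  ring

lemma measurable_real_sign : Measurable Real.sign := by
  unfold Real.sign
  exact Measurable.ite measurableSet_Iio measurable_const
    (Measurable.ite measurableSet_Ioi measurable_const measurable_const)

lemma abs_real_sign_le_one (x : ℝ) : |Real.sign x| ≤ 1 := by
  rcases Real.sign_apply_eq x with h | h | h <;> simp [h]

lemma integrable_id_mul_sign_mul_exp_lam {p0i p0j pij : ℝ} (hi : 0 < p0i) (hj : 0 < p0j)
    (hij : pij ^ 2 < p0i * p0j) (c κ : ℝ) :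
    Integrable (fun w : ℝ × ℝ =>
      w.1 * Real.sign w.2 * (κ * Real.exp (lam p0i p0j pij c w.1 w.2)))
      (volume.prod volume) := by
  set b := (2 * (p0i + p0j))⁻¹ with hb
  have hbpos : 0 < b := by positivity
  have hgauss : Integrable fun x : ℝ => Real.exp (-b * (x + c) ^ 2) :=
    (integrable_exp_neg_mul_sq hbpos).comp_add_right c
  have hmoment : Integrable fun x : ℝ => x * Real.exp (-b * (x + c) ^ 2) := by
    have h := ((integrable_mul_exp_neg_mul_sq hbpos).comp_add_right c).sub (hgauss.const_mul c)
    refine h.congr (Filter.Eventually.of_forall fun x => ?_)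
    simp only [Pi.sub_apply]
    ring
  refine ((hmoment.mul_prod hgauss).const_mul κ).mono ?_ (Filter.Eventually.of_forall fun w => ?_)
  · have := measurable_real_sign
    unfold lam
    exact Measurable.aestronglyMeasurable (by fun_prop)
  · have hexp := Real.exp_le_exp.mpr (lam_le hi hj hij c w.1 w.2)
    rw [Real.exp_add, ← hb] at hexp
    simp only [Real.norm_eq_abs, abs_mul, Real.abs_exp]
    calc |w.1| * |Real.sign w.2| * (|κ| * Real.exp (lam p0i p0j pij c w.1 w.2))
        ≤ |w.1| * 1 * (|κ| * (Real.exp (-b * (w.1 + c) ^ 2)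
            * Real.exp (-b * (w.2 + c) ^ 2))) := by
          gcongr
          exact abs_real_sign_le_one _
      _ = _ := by ring

/-- The modified Bussgang law for one-bit quantization with time-varying thresholds
(Theorem 2, equations (143)–(144), with the incomplete Gamma functions rewritten via
`Γ(1,x) = e^{-x}` and `Γ(1/2,x) = √π (1 - erf √x)`). -/
theorem modified_bussgang_one_bit (d p0i p0j pij : ℝ) (hi : 0 < p0i) (hj : 0 < p0j)
    (hij : pij ^ 2 < p0i * p0j) :
    (∫ wi : ℝ, ∫ wj : ℝ, wi * Real.sign wj *
        ((2 * Real.pi * Real.sqrt (p0i * p0j - pij ^ 2))⁻¹ *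
          Real.exp (lam p0i p0j pij d wi wj)))
      = (1 / p0j * (Real.sqrt (2 * p0j / Real.pi) * Real.exp (-d ^ 2 / (2 * p0j))
            + d * erf (d / Real.sqrt (2 * p0j)))) * pij
        - (-(1 / p0j) * erf (d / Real.sqrt (2 * p0j))) * d * (p0j - pij) := by
  have hD : 0 < p0i * p0j - pij ^ 2 := sub_pos.mpr hij
  rw [integral_integral_swap (integrable_id_mul_sign_mul_exp_lam hi hj hij d _)]
  set D := p0i * p0j - pij ^ 2 with hDdef
  set σ := Real.sqrt (2 * p0j) with hσ
  have hσpos : 0 < σ := by positivity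
  have hσsq : σ ^ 2 = 2 * p0j := Real.sq_sqrt (by positivity)
  have hsD : 0 < Real.sqrt D := by positivity
  have hsπ : 0 < Real.sqrt Real.pi := by positivity
  have hπ : Real.sqrt Real.pi ^ 2 = Real.pi := Real.sq_sqrt pi_pos.le
  have hmass : (2 * Real.pi * Real.sqrt D)⁻¹ * Real.sqrt (Real.pi / (p0j / (2 * D)))
      = (σ * Real.sqrt Real.pi)⁻¹ := by
    have h : Real.pi / (p0j / (2 * D)) = (2 * Real.sqrt Real.pi * Real.sqrt D / σ) ^ 2 := by
      rw [div_pow, mul_pow, mul_pow, hπ, hσsq, Real.sq_sqrt hD.le]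
      field_simp
    rw [h, Real.sqrt_sq (by positivity)]
    nth_rewrite 1 [← hπ]
    field_simp
  have hinner : ∀ wj : ℝ, ∫ wi : ℝ, wi * Real.sign wj *
        ((2 * Real.pi * Real.sqrt D)⁻¹ * Real.exp (lam p0i p0j pij d wi wj))
      = (σ * Real.sqrt Real.pi)⁻¹ * (Real.sign wj *
          ((-d + pij / p0j * σ * ((wj + d) / σ)) * Real.exp (-((wj + d) / σ) ^ 2))) := by
    intro wj
    have hrw : ∀ wi : ℝ, wi * Real.sign wj *
          ((2 * Real.pi * Real.sqrt D)⁻¹ * Real.exp (lam p0i p0j pij d wi wj))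
        = (Real.sign wj * (2 * Real.pi * Real.sqrt D)⁻¹ * Real.exp (-(wj + d) ^ 2 / (2 * p0j))) *
          (wi * Real.exp (-(p0j / (2 * D)) * (wi - (-d + pij / p0j * (wj + d))) ^ 2)) := by
      intro wi
      rw [lam_eq_completed_square hj hij, ← hDdef, Real.exp_add]
      ring
    simp_rw [hrw]
    rw [integral_const_mul, integral_id_mul_exp_neg_mul_sub_sq (by positivity), ← hmass,
      div_pow, hσsq, neg_div, mul_assoc (pij / p0j), mul_div_cancel₀ _ hσpos.ne']
    ring
  simp_rw [hinner]
  rw [integral_const_mul,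
    integral_sign_mul_comp_add_div
      (fun z => (-d + pij / p0j * σ * z) * Real.exp (-z ^ 2)) hσpos d]
  have hsplit : ∫ z : ℝ, Real.sign (z - d / σ) *
        ((-d + pij / p0j * σ * z) * Real.exp (-z ^ 2))
      = -d * -(Real.sqrt Real.pi * erf (d / σ))
        + pij / p0j * σ * Real.exp (-(d / σ) ^ 2) := by
    have hsign {g : ℝ → ℝ} (hg : Integrable g) :
        Integrable fun z => Real.sign (z - d / σ) * g z :=
      hg.bdd_mul (c := 1)
        (measurable_real_sign.comp (measurable_id.sub_const _)).aestronglyMeasurable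
        (Filter.Eventually.of_forall fun z => abs_real_sign_le_one _)
    rw [← integral_sign_sub_mul_exp_neg_sq, ← integral_sign_sub_mul_id_mul_exp_neg_sq,
      ← integral_const_mul, ← integral_const_mul,
      ← integral_add ((hsign integrable_exp_neg_sq).const_mul _)
        ((hsign integrable_id_mul_exp_neg_sq).const_mul _)]
    congr 1
    ext z
    ring
  rw [hsplit, Real.sqrt_div' _ pi_pos.le, ← hσ, div_pow, hσsq, neg_div]
  field_simp
  ring
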